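/- The two functionals â and ā on D(G) coincide: â(v) = ā(v) for every v ∈ D(G). Consequently, for every u ∈ X₊ the trajectory (V(t)u)_{t≥0} is honest if and only if it is mild honest. -/

import Mathlib

open Filter Topology Set MeasureTheory

noncomputable section

variable {X : Type*} [NormedAddCommGroup X] [NormedSpace ℝ X] [CompleteSpace X] [PartialOrder X]

/-- A `C₀`-semigroup on `X` (strong continuity required on `[0,∞)`). -/
structure IsC0Semigroup (T : ℝ → X →L[ℝ] X) : Prop where
  map_zero : T 0 = ContinuousLinearMap.id ℝ X
  map_add : ∀ s t : ℝ, 0 ≤ s → 0 ≤ t → T (s + t) = (T s).comp (T t)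
  strongCont : ∀ u : X, ContinuousOn (fun t => T t u) (Ici (0 : ℝ))

/-- A substochastic `C₀`-semigroup: positive and contracting on the positive cone. -/
def IsSubstochastic (T : ℝ → X →L[ℝ] X) : Prop :=
  IsC0Semigroup T ∧ ∀ t : ℝ, 0 ≤ t → ∀ u : X, 0 ≤ u → 0 ≤ T t u ∧ ‖T t u‖ ≤ ‖u‖

/-- `G` is the infinitesimal generator of the semigroup `T`. -/
def IsGeneratorOf (G : X →ₗ.[ℝ] X) (T : ℝ → X →L[ℝ] X) : Prop :=
  (∀ u : X, u ∈ G.domain ↔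
    ∃ v : X, Tendsto (fun t : ℝ => t⁻¹ • (T t u - u)) (𝓝[>] 0) (𝓝 v)) ∧
  ∀ u : G.domain, Tendsto (fun t : ℝ => t⁻¹ • (T t (u : X) - (u : X))) (𝓝[>] 0) (𝓝 (G u))

/-- The bounded operator `B(λ - A)⁻¹`, given the resolvent `R = (λ - A)⁻¹` of `A`. -/
def Jfun (A : X →ₗ.[ℝ] X) (B : A.domain →ₗ[ℝ] X) (R : X →L[ℝ] X)
    (hdom : ∀ u : X, R u ∈ A.domain) : X → X :=
  fun u => B ⟨R u, hdom u⟩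

/-- The functional `a(u) = -⟨Ψ, (A+B)u⟩` on `D(A)`. -/
def aFun (Ψ : X →L[ℝ] ℝ) (A : X →ₗ.[ℝ] X) (B : A.domain →ₗ[ℝ] X) (w : A.domain) : ℝ :=
  -Ψ (A w + B w)

/-- The value `ā((λ-G)⁻¹u) = Σₙ a((λ-A)⁻¹[B(λ-A)⁻¹]ⁿ u)`, expressed through the
resolvent `R = (λ-A)⁻¹` of `A`. -/
def abarRes (Ψ : X →L[ℝ] ℝ) (A : X →ₗ.[ℝ] X) (B : A.domain →ₗ[ℝ] X)
    (R : X →L[ℝ] X) (hdom : ∀ u : X, R u ∈ A.domain) (u : X) : ℝ :=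
  ∑' n : ℕ, aFun Ψ A B ⟨R ((Jfun A B R hdom)^[n] u), hdom _⟩

/-- `⟨Ξ_λ, u⟩ = a₀((λ-G)⁻¹u) - ā((λ-G)⁻¹u)`, where `RA = (λ-A)⁻¹`, `RG = (λ-G)⁻¹` and
`a₀(v) = -⟨Ψ, G v⟩`. -/
def xiRes (Ψ : X →L[ℝ] ℝ) (A : X →ₗ.[ℝ] X) (B : A.domain →ₗ[ℝ] X) (G : X →ₗ.[ℝ] X)
    (RA RG : X →L[ℝ] X) (hAdom : ∀ u : X, RA u ∈ A.domain)
    (hGdom : ∀ u : X, RG u ∈ G.domain) (u : X) : ℝ :=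
  (-(Ψ (G ⟨RG u, hGdom u⟩))) - abarRes Ψ A B RA hAdom u

/-- The functional `ā` on `D(G)`: `ā(v) = ā((λ-G)⁻¹ u)` for `u = λ v - G v`
(written through the resolvent `R = (λ-A)⁻¹`). -/
def abarOn (Ψ : X →L[ℝ] ℝ) (A : X →ₗ.[ℝ] X) (B : A.domain →ₗ[ℝ] X) (G : X →ₗ.[ℝ] X)
    (R : X →L[ℝ] X) (hdom : ∀ u : X, R u ∈ A.domain) (l : ℝ) (v : G.domain) : ℝ :=
  abarRes Ψ A B R hdom (l • (v : X) - G v)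

/-- `v` belongs to the domain of the closure of `(A + B, D(A))` (together with a limit of
the corresponding values). -/
def InClosureDomain (A : X →ₗ.[ℝ] X) (B : A.domain →ₗ[ℝ] X) (v : X) : Prop :=
  ∃ (f : ℕ → A.domain) (w : X),
    Tendsto (fun n => ((f n : X))) atTop (𝓝 v) ∧
    Tendsto (fun n => A (f n) + B (f n)) atTop (𝓝 w)

/-- The functional `â(v) = lim_{t→0⁺} (1/t) Σₙ a(∫₀ᵗ Vₙ(s)v ds)` defined through the
Dyson–Phillips iterates. -/
def ahatFun (Ψ : X →L[ℝ] ℝ) (A : X →ₗ.[ℝ] X) (B : A.domain →ₗ[ℝ] X)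
    (Vn : ℕ → ℝ → X →L[ℝ] X)
    (memInt : ∀ (n : ℕ) (t : ℝ) (u : X), (∫ s in (0:ℝ)..t, Vn n s u) ∈ A.domain)
    (v : X) : ℝ :=
  limUnder (𝓝[>] (0:ℝ)) fun t =>
    t⁻¹ * ∑' n : ℕ, aFun Ψ A B ⟨∫ s in (0:ℝ)..t, Vn n s v, memInt n t v⟩

set_option linter.unusedSectionVars false
section Helpers

variable {E : Type*} [NormedAddCommGroup E] [NormedSpace ℝ E] [CompleteSpace E]

lemma cone_int {K : Set E} (hcl : IsClosed K) (hadd : ∀ u ∈ K, ∀ v ∈ K, u + v ∈ K)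
    (hsm : ∀ c : ℝ, 0 ≤ c → ∀ u ∈ K, c • u ∈ K) (h0 : (0 : E) ∈ K)
    {f : ℝ → E} {a b : ℝ} (hab : a ≤ b) (hf : IntervalIntegrable f volume a b)
    (hfK : ∀ s, a < s → s ≤ b → f s ∈ K) : (∫ s in a..b, f s) ∈ K := by
  rcases hab.eq_or_lt with rfl | hab'
  · simpa using h0
  have hconv : Convex ℝ K := by
    intro x hx y hy c d hc hd _
    exact hadd _ (hsm c hc x hx) _ (hsm d hd y hy)
  have h1 : (⨍ s in Ioc a b, f s) ∈ K := by
    refine hconv.set_average_mem hcl ?_ ?_ ?_ ?_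
    · simp [hab']
    · simp
    · exact (ae_restrict_iff' measurableSet_Ioc).2 (Eventually.of_forall fun s hs => hfK s hs.1 hs.2)
    · exact (intervalIntegrable_iff_integrableOn_Ioc_of_le hab).1 hf
  have h2 : (∫ s in a..b, f s) = (b - a) • (⨍ s in Ioc a b, f s) := by
    rw [intervalIntegral.integral_of_le hab, setAverage_eq, smul_smul]
    have : (volume.real (Ioc a b)) = b - a := by simp [hab]
    rw [this, mul_inv_cancel₀ (by linarith), one_smul]
  rw [h2]
  exact hsm _ (by linarith) _ h1

lemma joint_cont {T : ℝ → E →L[ℝ] E} (hc : ∀ u, ContinuousOn (fun t => T t u) (Ici (0 : ℝ)))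
    {M : ℝ} (hM : ∀ t, 0 ≤ t → ∀ u, ‖T t u‖ ≤ M * ‖u‖) :
    Continuous (fun p : ℝ × E => T (max p.1 0) p.2) := by
  refine continuous_prod_of_continuous_lipschitzWith' _ (Real.toNNReal (max M 0)) ?_ ?_
  · intro t
    refine LipschitzWith.of_dist_le_mul fun x y => ?_
    rw [dist_eq_norm, dist_eq_norm, ← map_sub, Real.coe_toNNReal _ (le_max_right _ _)]
    exact (hM _ (le_max_right _ _) _).trans (by gcongr; exact le_max_left _ _)
  · intro u
    have : Continuous (fun t : ℝ => max t 0) := by fun_prop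
    exact (hc u).comp_continuous this (fun t => mem_Ici.2 (le_max_right _ _))

lemma lap_integrable {f : ℝ → E} (hc : ContinuousOn f (Ici (0 : ℝ)))
    {C : ℝ} (hC : ∀ t, 0 ≤ t → ‖f t‖ ≤ C) :
    IntegrableOn (fun t => Real.exp (-t) • f t) (Ioi 0) := by
  have h1 : IntegrableOn (fun t : ℝ => C * Real.exp (-t)) (Ioi 0) :=
    (integrableOn_exp_neg_Ioi 0).const_mul C
  refine Integrable.mono' h1 ?_ ?_
  · refine ContinuousOn.aestronglyMeasurable ?_ measurableSet_Ioi
    exact (by fun_prop : Continuous fun t : ℝ => Real.exp (-t)).continuousOn.smul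
      (hc.mono Ioi_subset_Ici_self)
  · refine (ae_restrict_iff' measurableSet_Ioi).2 (Eventually.of_forall fun t ht => ?_)
    rw [norm_smul, Real.norm_of_nonneg (Real.exp_pos _).le, mul_comm]
    have := hC t (le_of_lt ht)
    have := (Real.exp_pos (-t)).le
    gcongr

/-- Laplace transform at `1` as a continuous linear map. -/
lemma lap_clm {T : ℝ → E →L[ℝ] E} (hc : ∀ u, ContinuousOn (fun t => T t u) (Ici (0 : ℝ)))
    {M : ℝ} (hM : ∀ t, 0 ≤ t → ∀ u, ‖T t u‖ ≤ M * ‖u‖) :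
    ∃ L : E →L[ℝ] E, ∀ u, L u = ∫ t in Ioi (0 : ℝ), Real.exp (-t) • T t u := by
  have hi : ∀ u, IntegrableOn (fun t => Real.exp (-t) • T t u) (Ioi 0) := fun u =>
    lap_integrable (hc u) (fun t ht => hM t ht u)
  let L : E →ₗ[ℝ] E :=
    { toFun := fun u => ∫ t in Ioi (0 : ℝ), Real.exp (-t) • T t u
      map_add' := by
        intro u v
        rw [← integral_add (hi u) (hi v)]
        simp
      map_smul' := by
        intro c u
        rw [RingHom.id_apply, ← integral_smul]
        simp [smul_comm c] }
  refine ⟨L.mkContinuous M ?_, fun u => rfl⟩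
  intro u
  change ‖∫ t in Ioi (0 : ℝ), Real.exp (-t) • T t u‖ ≤ M * ‖u‖
  have h1 : IntegrableOn (fun t : ℝ => (M * ‖u‖) * Real.exp (-t)) (Ioi 0) :=
    (integrableOn_exp_neg_Ioi 0).const_mul _
  have := norm_integral_le_of_norm_le (f := fun t => Real.exp (-t) • T t u) h1 ?_
  · refine this.trans (le_of_eq ?_)
    rw [integral_const_mul, integral_exp_neg_Ioi_zero, mul_one]
  · refine (ae_restrict_iff' measurableSet_Ioi).2 (Eventually.of_forall fun t ht => ?_)
    rw [norm_smul, Real.norm_of_nonneg (Real.exp_pos _).le, mul_comm]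
    have := hM t (le_of_lt ht) u
    have := (Real.exp_pos (-t)).le
    gcongr

lemma lap_conv {T : ℝ → E →L[ℝ] E} (hc : ∀ u, ContinuousOn (fun t => T t u) (Ici (0 : ℝ)))
    {M : ℝ} (hM : ∀ t, 0 ≤ t → ∀ u, ‖T t u‖ ≤ M * ‖u‖)
    {g : ℝ → E} (hg : Continuous g) {C : ℝ} (hC : ∀ t, ‖g t‖ ≤ C) (hM0 : 0 ≤ M)
    (L : E →L[ℝ] E) (hL : ∀ u, L u = ∫ t in Ioi (0 : ℝ), Real.exp (-t) • T t u) :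
    (∫ t in Ioi (0 : ℝ), Real.exp (-t) • ∫ s in (0:ℝ)..t, T (t - s) (g s)) =
      L (∫ s in Ioi (0 : ℝ), Real.exp (-s) • g s) := by
  set f : ℝ → ℝ := (Ioi (0:ℝ)).indicator (fun s => Real.exp (-s)) with hf
  have hfm : Measurable f := (by fun_prop : Measurable fun s : ℝ => Real.exp (-s)).indicator
    measurableSet_Ioi
  have hfi : Integrable f := (integrable_indicator_iff measurableSet_Ioi).2
    (integrableOn_exp_neg_Ioi 0)
  set H : ℝ → ℝ → E := fun t s => (f s * f (t - s)) • T (max (t - s) 0) (g s) with hH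
  have hHi : Integrable (Function.uncurry H) (volume.prod volume) := by
    have h1 := (hfi.convolution_integrand (ContinuousLinearMap.mul ℝ ℝ) hfi).norm.const_mul (M * C)
    refine h1.mono' ?_ ?_
    · refine AEStronglyMeasurable.smul ?_ ?_
      · refine Measurable.aestronglyMeasurable ?_
        exact (hfm.comp measurable_snd).mul (hfm.comp (measurable_fst.sub measurable_snd))
      · refine Continuous.aestronglyMeasurable ?_
        exact (joint_cont hc hM).comp
          ((continuous_fst.sub continuous_snd).prodMk (hg.comp continuous_snd))
    · refine Eventually.of_forall fun p => ?_
      simp only [Function.uncurry, hH, norm_smul, ContinuousLinearMap.mul_apply']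
      rw [mul_comm]
      gcongr
      exact (hM _ (le_max_right _ _) _).trans (by gcongr; exact hC _)
  have h1 : (∫ t in Ioi (0 : ℝ), Real.exp (-t) • ∫ s in (0:ℝ)..t, T (t - s) (g s)) =
      ∫ t, ∫ s, H t s := by
    rw [← integral_indicator measurableSet_Ioi]
    congr 1
    ext t
    by_cases ht : 0 < t
    · rw [indicator_of_mem (show t ∈ Ioi (0:ℝ) from ht), intervalIntegral.integral_of_le ht.le, 
        ← integral_Ioc_eq_integral_Ioo.symm, ← integral_smul, ← integral_indicator measurableSet_Ioo]
      congr 1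
      ext s
      by_cases hs : s ∈ Ioo 0 t
      · have e1 : f s = Real.exp (-s) := indicator_of_mem (show s ∈ Ioi (0:ℝ) from hs.1) _
        have e2 : f (t - s) = Real.exp (-(t - s)) :=
          indicator_of_mem (show t - s ∈ Ioi (0:ℝ) from sub_pos.2 hs.2) _
        rw [indicator_of_mem hs]
        simp only [hH, e1, e2, ← Real.exp_add]
        rw [max_eq_left (sub_nonneg.2 hs.2.le)]
        congr 2
        ring
      · rw [indicator_of_notMem hs]
        have : f s * f (t - s) = 0 := by
          by_cases h : 0 < s
          · have : f (t - s) = 0 := indicator_of_notMem (by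
              intro h'; exact hs ⟨h, by simpa using h'⟩) _
            rw [this, mul_zero]
          · have : f s = 0 := indicator_of_notMem (by simpa using h) _
            rw [this, zero_mul]
        simp [hH, this]
    · rw [indicator_of_notMem (show t ∉ Ioi (0:ℝ) from ht)]
      symm
      refine integral_eq_zero_of_ae (Eventually.of_forall fun s => ?_)
      have : f s * f (t - s) = 0 := by
        by_cases h : 0 < s
        · have : f (t - s) = 0 := indicator_of_notMem (by
            intro h'; simp at h' ht; linarith) _
          rw [this, mul_zero]
        · have : f s = 0 := indicator_of_notMem (by simpa using h) _
          rw [this, zero_mul]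
      simp [hH, this]
  rw [h1, integral_integral_swap hHi, ← L.integral_comp_comm
    (lap_integrable hg.continuousOn (fun t _ => hC t)), ← integral_indicator measurableSet_Ioi]
  congr 1
  ext s
  by_cases hs : 0 < s
  · rw [indicator_of_mem (show s ∈ Ioi (0:ℝ) from hs), map_smul, hL, ← integral_smul,
      ← integral_add_right_eq_self (fun t => H t s) s, ← integral_indicator measurableSet_Ioi]
    congr 1
    ext r
    have e1 : f s = Real.exp (-s) := indicator_of_mem (show s ∈ Ioi (0:ℝ) from hs) _
    by_cases hr : 0 < r
    · have e2 : f r = Real.exp (-r) := indicator_of_mem (show r ∈ Ioi (0:ℝ) from hr) _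
      rw [indicator_of_mem (show r ∈ Ioi (0:ℝ) from hr)]
      simp only [hH, add_sub_cancel_right, e1, e2, max_eq_left hr.le, smul_smul]
    · have e2 : f r = 0 := indicator_of_notMem (by simpa using hr) _
      rw [indicator_of_notMem (show r ∉ Ioi (0:ℝ) from hr)]
      simp [hH, e2]
  · rw [indicator_of_notMem (show s ∉ Ioi (0:ℝ) from hs)]
    refine integral_eq_zero_of_ae (Eventually.of_forall fun t => ?_)
    have : f s = 0 := indicator_of_notMem (by simpa using hs) _
    simp [hH, this]

end Helpers
set_option linter.unusedSectionVars false

section Core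

variable {E : Type*} [NormedAddCommGroup E] [NormedSpace ℝ E] [CompleteSpace E]

lemma ii_of_cont {f : ℝ → E} (hc : ContinuousOn f (Ici (0 : ℝ))) {a b : ℝ} (ha : 0 ≤ a)
    (hb : 0 ≤ b) : IntervalIntegrable f volume a b := by
  refine ContinuousOn.intervalIntegrable (hc.mono fun x hx => ?_)
  have := hx.1
  exact le_trans (le_min ha hb) this

lemma formulaF {Vn : ℕ → ℝ → E →L[ℝ] E}
    (hVc : ∀ (n : ℕ) (u : E), ContinuousOn (fun t => Vn n t u) (Ici (0 : ℝ)))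
    {M : ℕ → ℝ} (hM : ∀ n t, 0 ≤ t → ∀ u, ‖Vn n t u‖ ≤ M n * ‖u‖)
    (SL : ∀ m t s, 0 ≤ t → 0 ≤ s → ∀ u, Vn m (t + s) u =
      ∑ p ∈ Finset.HasAntidiagonal.antidiagonal m, Vn p.1 t (Vn p.2 s u))
    {I : ℕ → E → E} (hI : ∀ m u, I m u = ∫ t in Ioi (0 : ℝ), Real.exp (-t) • Vn m t u)
    (m : ℕ) (u : E) (t : ℝ) (ht : 0 ≤ t) :
    ∑ p ∈ Finset.HasAntidiagonal.antidiagonal m, Vn p.1 t (I p.2 u) =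
      Real.exp t • (I m u - ∫ s in (0:ℝ)..t, Real.exp (-s) • Vn m s u) := by
  have hi : ∀ n, IntegrableOn (fun t => Real.exp (-t) • Vn n t u) (Ioi 0) := fun n =>
    lap_integrable (hVc n u) (fun t ht => hM n t ht u)
  have h1 : ∀ p ∈ Finset.HasAntidiagonal.antidiagonal m, Vn p.1 t (I p.2 u) =
      ∫ s in Ioi (0 : ℝ), Vn p.1 t (Real.exp (-s) • Vn p.2 s u) := by
    intro p _
    rw [hI, ContinuousLinearMap.integral_comp_comm _ (hi p.2)]
  rw [Finset.sum_congr rfl h1, ← integral_finsetSum]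
  swap
  · intro p _
    exact (Vn p.1 t).integrable_comp (hi p.2)
  have h2 : ∀ s ∈ Ioi (0:ℝ), ∑ p ∈ Finset.HasAntidiagonal.antidiagonal m, Vn p.1 t (Real.exp (-s) • Vn p.2 s u)
      = Real.exp t • (Real.exp (-(s + t)) • Vn m (s + t) u) := by
    intro s hs
    rw [add_comm s t, SL m t s ht (le_of_lt hs), smul_smul, ← Real.exp_add, Finset.smul_sum]
    refine Finset.sum_congr rfl fun p _ => ?_
    rw [map_smul]
    congr 2
    ring
  rw [setIntegral_congr_fun measurableSet_Ioi h2, integral_smul]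
  congr 1
  have h3 : (∫ s in Ioi (0:ℝ), Real.exp (-(s + t)) • Vn m (s + t) u) =
      ∫ s in Ioi t, Real.exp (-s) • Vn m s u := by
    rw [← integral_indicator measurableSet_Ioi, ← integral_indicator measurableSet_Ioi,
      ← integral_add_right_eq_self ((Ioi t).indicator fun s => Real.exp (-s) • Vn m s u) t]
    congr 1
    ext s
    simp [indicator]
  rw [h3, hI, eq_sub_iff_add_eq, add_comm]
  refine intervalIntegral.integral_interval_add_Ioi (hi m) ((hi m).mono_set (Ioi_subset_Ioi ht))

lemma core {K : Set E} (hcl : IsClosed K) (hadd : ∀ u ∈ K, ∀ v ∈ K, u + v ∈ K)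
    (hsm : ∀ c : ℝ, 0 ≤ c → ∀ u ∈ K, c • u ∈ K) (h0 : (0 : E) ∈ K)
    (D : Submodule ℝ E) (α : E →ₗ[ℝ] ℝ) (hα : ∀ w ∈ D, w ∈ K → 0 ≤ α w)
    {Vn : ℕ → ℝ → E →L[ℝ] E}
    (hVc : ∀ (n : ℕ) (u : E), ContinuousOn (fun t => Vn n t u) (Ici (0 : ℝ)))
    {M : ℕ → ℝ} (hM : ∀ n t, 0 ≤ t → ∀ u, ‖Vn n t u‖ ≤ M n * ‖u‖)
    (hpos : ∀ n t, 0 ≤ t → ∀ u ∈ K, Vn n t u ∈ K)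
    (SL : ∀ m t s, 0 ≤ t → 0 ≤ s → ∀ u, Vn m (t + s) u =
      ∑ p ∈ Finset.HasAntidiagonal.antidiagonal m, Vn p.1 t (Vn p.2 s u))
    (memD : ∀ (n : ℕ) (t : ℝ) (u : E), (∫ s in (0:ℝ)..t, Vn n s u) ∈ D)
    (hαc : ∀ (n : ℕ) (t : ℝ), 0 ≤ t → Continuous fun u => α (∫ s in (0:ℝ)..t, Vn n s u))
    {I : ℕ → E → E} (hI : ∀ m u, I m u = ∫ t in Ioi (0 : ℝ), Real.exp (-t) • Vn m t u)
    (hID : ∀ m u, I m u ∈ D)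
    {u v : E} (hu : u ∈ K) (hsum : Summable fun m => α (I m u))
    (hv : Tendsto (fun n : ℕ => ∑ k ∈ Finset.range (n + 1), I k u) atTop (𝓝 v))
    {σ : ℝ → ℝ} (hσ : ∀ h, 0 ≤ h → ∀ N : ℕ,
      ∑ n ∈ Finset.range N, α (∫ s in (0:ℝ)..h, Vn n s u) ≤ σ h)
    (hσ0 : Tendsto σ (𝓝[>] 0) (𝓝 0)) :
    (∀ h, 0 ≤ h → Summable fun n => α (∫ s in (0:ℝ)..h, Vn n s v)) ∧
    Tendsto (fun h : ℝ => h⁻¹ * ∑' n, α (∫ s in (0:ℝ)..h, Vn n s v)) (𝓝[>] 0)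
      (𝓝 (∑' m, α (I m u))) := by
  have hii : ∀ n (w : E) a b, 0 ≤ a → 0 ≤ b →
      IntervalIntegrable (fun s => Vn n s w) volume a b := fun n w a b ha hb =>
    ii_of_cont (hVc n w) ha hb
  have hintK : ∀ n h, 0 ≤ h → ∀ w ∈ K, (∫ s in (0:ℝ)..h, Vn n s w) ∈ K := fun n h hh w hw =>
    cone_int hcl hadd hsm h0 hh (hii n w 0 h le_rfl hh) (fun s hs _ => hpos n s hs.le w hw)
  have hecont : ∀ n (w : E), ContinuousOn (fun s => Real.exp (-s) • Vn n s w) (Ici (0:ℝ)) :=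
    fun n w => (by fun_prop : Continuous fun t : ℝ => Real.exp (-t)).continuousOn.smul (hVc n w)
  have hIK : ∀ n, I n u ∈ K := by
    intro n
    rw [hI]
    have h1 := intervalIntegral_tendsto_integral_Ioi (0:ℝ)
      (lap_integrable (hVc n u) (fun t ht => hM n t ht u)) tendsto_id
    refine hcl.mem_of_tendsto h1 ?_
    filter_upwards [eventually_ge_atTop 0] with T hT
    exact cone_int hcl hadd hsm h0 hT (ii_of_cont (hecont n u) le_rfl hT)
      (fun s hs _ => hsm _ (Real.exp_pos _).le _ (hpos n s hs.le u hu))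
  -- the small functional
  set S : ℝ → ℝ := fun h => ∑' n, α (∫ s in (0:ℝ)..h, Vn n s u) with hS
  have hSnn : ∀ h, 0 ≤ h → ∀ n, 0 ≤ α (∫ s in (0:ℝ)..h, Vn n s u) := fun h hh n =>
    hα _ (memD _ _ _) (hintK n h hh u hu)
  have hSsum : ∀ h, 0 ≤ h → Summable fun n => α (∫ s in (0:ℝ)..h, Vn n s u) := fun h hh =>
    summable_of_sum_range_le (hSnn h hh) (hσ h hh)
  have hSle : ∀ h, 0 ≤ h → S h ≤ σ h := fun h hh =>
    Real.tsum_le_of_sum_range_le (hSnn h hh) (hσ h hh)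
  -- the double family
  have main : ∀ h, 0 ≤ h → Summable (fun n => α (∫ s in (0:ℝ)..h, Vn n s v)) ∧
      ∃ ε, 0 ≤ ε ∧ ε ≤ (Real.exp h - 1) * S h ∧
        ∑' n, α (∫ s in (0:ℝ)..h, Vn n s v) = (Real.exp h - 1) * ∑' m, α (I m u) - ε := by
    intro h hh
    set F : ℕ × ℕ → ℝ := fun p => α (∫ s in (0:ℝ)..h, Vn p.1 s (I p.2 u)) with hF
    have hF0 : ∀ p, 0 ≤ F p := fun p => hα _ (memD _ _ _) (hintK _ h hh _ (hIK _))
    -- remainder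
    set w : ℕ → E := fun m =>
      ∫ t in (0:ℝ)..h, Real.exp t • ∫ s in (0:ℝ)..t, Real.exp (-s) • Vn m s u with hw
    have hprim : ∀ m, ContinuousOn (fun t => ∫ s in (0:ℝ)..t, Real.exp (-s) • Vn m s u)
        (Ici (0:ℝ)) := by
      intro m
      have hc : Continuous fun t : ℝ => ∫ s in (0:ℝ)..t, Real.exp (-s) • Vn m (max s 0) u := by
        refine intervalIntegral.continuous_primitive (fun a b => Continuous.intervalIntegrable ?_ a b) 0
        exact (by fun_prop : Continuous fun t : ℝ => Real.exp (-t)).smul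
          ((hVc m u).comp_continuous (by fun_prop) (fun t => mem_Ici.2 (le_max_right _ _)))
      refine hc.continuousOn.congr fun t ht => ?_
      refine intervalIntegral.integral_congr fun s hs => ?_
      rw [uIcc_of_le ht] at hs
      simp only [max_eq_left hs.1]
    have hexpc : Continuous fun t : ℝ => Real.exp t := Real.continuous_exp
    have hwii : ∀ m, IntervalIntegrable
        (fun t => Real.exp t • ∫ s in (0:ℝ)..t, Real.exp (-s) • Vn m s u) volume 0 h :=
      fun m => ii_of_cont (hexpc.continuousOn.smul (hprim m)) le_rfl hh
    have hci : ∀ x : E, IntervalIntegrable (fun t : ℝ => Real.exp t • x) volume 0 h := fun x =>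
      Continuous.intervalIntegrable (by fun_prop) 0 h
    have hexpint : ∀ x : E, (∫ t in (0:ℝ)..h, Real.exp t • x) = (Real.exp h - 1) • x := by
      intro x
      rw [intervalIntegral.integral_smul_const, integral_exp, Real.exp_zero]
    have hdec : ∀ m, ∑ p ∈ Finset.HasAntidiagonal.antidiagonal m, (∫ s in (0:ℝ)..h, Vn p.1 s (I p.2 u)) =
        (Real.exp h - 1) • I m u - w m := by
      intro m
      rw [← intervalIntegral.integral_finsetSum (fun p _ => hii p.1 _ 0 h le_rfl hh),
        ← hexpint]
      simp only [hw]
      rw [← intervalIntegral.integral_sub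
          (hci _) (hwii m)]
      refine intervalIntegral.integral_congr fun t ht => ?_
      rw [uIcc_of_le hh] at ht
      rw [formulaF hVc hM SL hI m u t ht.1, smul_sub]
    have hwD : ∀ m, w m ∈ D := by
      intro m
      have : w m = (Real.exp h - 1) • I m u -
        ∑ p ∈ Finset.HasAntidiagonal.antidiagonal m, (∫ s in (0:ℝ)..h, Vn p.1 s (I p.2 u)) := by
        rw [hdec]; abel
      rw [this]
      exact D.sub_mem (D.smul_mem _ (hID _ _)) (D.sum_mem fun p _ => memD _ _ _)
    have hwK : ∀ m, w m ∈ K := by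
      intro m
      refine cone_int hcl hadd hsm h0 hh (hwii m) fun t ht _ => hsm _ (Real.exp_pos _).le _ ?_
      exact cone_int hcl hadd hsm h0 ht.le (ii_of_cont (hecont m u) le_rfl ht.le)
        (fun s hs _ => hsm _ (Real.exp_pos _).le _ (hpos m s hs.le u hu))
    have hwK2 : ∀ m, (Real.exp h - 1) • (∫ s in (0:ℝ)..h, Vn m s u) - w m ∈ K := by
      intro m
      rw [← hexpint]
      simp only [hw]
      rw [← intervalIntegral.integral_sub
          (hci _) (hwii m)]
      refine cone_int hcl hadd hsm h0 hh
        ((hci _).sub (hwii m)) fun t ht hth => ?_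
      rw [← smul_sub]
      refine hsm _ (Real.exp_pos _).le _ ?_
      rw [← intervalIntegral.integral_add_adjacent_intervals (hii m u 0 t le_rfl ht.le)
        (hii m u t h ht.le hh), add_sub_right_comm, ← intervalIntegral.integral_sub
          (hii m u 0 t le_rfl ht.le) (ii_of_cont (hecont m u) le_rfl ht.le)]
      refine hadd _ ?_ _ ?_
      · refine cone_int hcl hadd hsm h0 ht.le ((hii m u 0 t le_rfl ht.le).sub
          (ii_of_cont (hecont m u) le_rfl ht.le)) fun s hs _ => ?_
        have : Vn m s u - Real.exp (-s) • Vn m s u = (1 - Real.exp (-s)) • Vn m s u := by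
          rw [sub_smul, one_smul]
        rw [this]
        refine hsm _ ?_ _ (hpos m s hs.le u hu)
        have : Real.exp (-s) ≤ 1 := Real.exp_le_one_iff.2 (by linarith)
        linarith
      · exact cone_int hcl hadd hsm h0 hth (hii m u t h ht.le hh)
          fun s hs _ => hpos m s (ht.le.trans hs.le) u hu
    have hw0 : ∀ m, 0 ≤ α (w m) := fun m => hα _ (hwD m) (hwK m)
    have hw1 : ∀ m, α (w m) ≤ (Real.exp h - 1) * α (∫ s in (0:ℝ)..h, Vn m s u) := by
      intro m
      have := hα _ (D.sub_mem (D.smul_mem _ (memD m h u)) (hwD m)) (hwK2 m)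
      rw [map_sub, map_smul, smul_eq_mul] at this
      linarith
    have hwsum : Summable fun m => α (w m) :=
      Summable.of_nonneg_of_le hw0 hw1 ((hSsum h hh).mul_left _)
    have hanti : ∀ m, ∑ p ∈ Finset.HasAntidiagonal.antidiagonal m, F p =
        (Real.exp h - 1) * α (I m u) - α (w m) := by
      intro m
      have := congrArg α (hdec m)
      rw [map_sum, map_sub, map_smul, smul_eq_mul] at this
      exact this
    have hantisum : HasSum (fun m => ∑ p ∈ Finset.HasAntidiagonal.antidiagonal m, F p)
        ((Real.exp h - 1) * ∑' m, α (I m u) - ∑' m, α (w m)) := by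
      simp only [hanti]
      exact (hsum.hasSum.mul_left _).sub hwsum.hasSum
    have hsig : Summable (fun x : Σ n : ℕ, Finset.HasAntidiagonal.antidiagonal n => F x.2) := by
      rw [summable_sigma_of_nonneg (fun x => hF0 _)]
      refine ⟨fun m => (hasSum_fintype _).summable, ?_⟩
      convert hantisum.summable using 2 with m
      rw [tsum_fintype]
      exact Finset.sum_coe_sort (Finset.HasAntidiagonal.antidiagonal m) F
    have hFs : Summable F :=
      Finset.HasAntidiagonal.sigmaAntidiagonalEquivProd.summable_iff.1 hsig
    have hFt : ∑' p, F p = ((Real.exp h - 1) * ∑' m, α (I m u) - ∑' m, α (w m)) := by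
      rw [← Finset.HasAntidiagonal.sigmaAntidiagonalEquivProd.tsum_eq F]
      change ∑' x : Σ n : ℕ, Finset.HasAntidiagonal.antidiagonal n, F x.2 = _
      rw [hsig.tsum_sigma' (fun m => (hasSum_fintype _).summable), ← hantisum.tsum_eq]
      congr 1
      ext m
      rw [tsum_fintype]
      exact Finset.sum_coe_sort (Finset.HasAntidiagonal.antidiagonal m) F
    have hrow : ∀ n, HasSum (fun k => F (n, k)) (α (∫ s in (0:ℝ)..h, Vn n s v)) := by
      intro n
      rw [hasSum_iff_tendsto_nat_of_nonneg (fun k => hF0 _), ← tendsto_add_atTop_iff_nat 1]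
      have h1 := ((hαc n h hh).tendsto v).comp hv
      refine h1.congr fun N => ?_
      simp only [Function.comp, hF, map_sum]
      rw [intervalIntegral.integral_finsetSum (fun p _ => hii n _ 0 h le_rfl hh), map_sum]
    have hprod : HasSum (fun n => α (∫ s in (0:ℝ)..h, Vn n s v)) (∑' p, F p) :=
      hFs.hasSum.prod_fiberwise hrow
    refine ⟨hprod.summable, ∑' m, α (w m), tsum_nonneg hw0, ?_, ?_⟩
    · rw [hS, ← tsum_mul_left]
      exact hwsum.tsum_le_tsum hw1 ((hSsum h hh).mul_left _)
    · rw [hprod.tsum_eq, hFt]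
  refine ⟨fun h hh => (main h hh).1, ?_⟩
  have hexp : Tendsto (fun h : ℝ => h⁻¹ * (Real.exp h - 1)) (𝓝[>] 0) (𝓝 1) := by
    have h1 := (Real.hasDerivAt_exp 0).tendsto_slope_zero_right
    simpa using h1
  have hlow : Tendsto (fun h : ℝ => h⁻¹ * (Real.exp h - 1) * ∑' m, α (I m u) -
      h⁻¹ * (Real.exp h - 1) * σ h) (𝓝[>] 0) (𝓝 (∑' m, α (I m u))) := by
    have := (hexp.mul_const (∑' m, α (I m u))).sub (hexp.mul hσ0)
    simpa using this
  have hupp : Tendsto (fun h : ℝ => h⁻¹ * (Real.exp h - 1) * ∑' m, α (I m u))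
      (𝓝[>] 0) (𝓝 (∑' m, α (I m u))) := by
    simpa using (hexp.mul_const (∑' m, α (I m u)))
  refine tendsto_of_tendsto_of_tendsto_of_le_of_le' hlow hupp ?_ ?_
  · filter_upwards [self_mem_nhdsWithin] with h hh
    have hh : 0 < h := hh
    obtain ⟨-, ε, hε0, hε1, hε⟩ := main h hh.le
    rw [hε, mul_assoc, mul_assoc, ← mul_sub]
    have : 0 ≤ Real.exp h - 1 := by linarith [Real.add_one_le_exp h]
    have := mul_le_mul_of_nonneg_left (hSle h hh.le) this
    gcongr
    linarith
  · filter_upwards [self_mem_nhdsWithin] with h hh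
    have hh : 0 < h := hh
    obtain ⟨-, ε, hε0, hε1, hε⟩ := main h hh.le
    rw [hε, mul_assoc]
    gcongr
    linarith

end Core
section Semi

variable {E : Type*} [NormedAddCommGroup E] [NormedSpace ℝ E] [CompleteSpace E]

lemma dyson_SL {Vn : ℕ → ℝ → E →L[ℝ] E}
    (hVc : ∀ (n : ℕ) (u : E), ContinuousOn (fun t => Vn n t u) (Ici (0 : ℝ)))
    {M : ℕ → ℝ} (hM : ∀ n t, 0 ≤ t → ∀ u, ‖Vn n t u‖ ≤ M n * ‖u‖)
    (D : Submodule ℝ E) (hD : Dense (D : Set E)) (b : D → ℝ → E) (hb : ∀ u, Continuous (b u))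
    (hrec : ∀ n t, 0 ≤ t → ∀ u : D, Vn (n + 1) t (u : E) = ∫ s in (0:ℝ)..t, Vn n (t - s) (b u s))
    (hUD : ∀ s, 0 ≤ s → ∀ u : D, Vn 0 s (u : E) ∈ D)
    (hbU : ∀ s (hs : 0 ≤ s) (u : D) r, 0 ≤ r → b ⟨Vn 0 s (u : E), hUD s hs u⟩ r = b u (r + s))
    (hU : ∀ t s, 0 ≤ t → 0 ≤ s → ∀ u, Vn 0 (t + s) u = Vn 0 t (Vn 0 s u)) :
    ∀ m t s, 0 ≤ t → 0 ≤ s → ∀ u, Vn m (t + s) u =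
      ∑ p ∈ Finset.HasAntidiagonal.antidiagonal m, Vn p.1 t (Vn p.2 s u) := by
  intro m
  induction m with
  | zero =>
    intro t s ht hs u
    simpa using hU t s ht hs u
  | succ m ih =>
    intro t s ht hs u
    have hcc : ∀ n (τ : ℝ) (u : D), Continuous fun r => Vn n (max (τ - r) 0) (b u r) := by
      intro n τ u
      exact (joint_cont (hVc n) (hM n)).comp
        ((continuous_const.sub continuous_id).prodMk (hb u))
    have hiii : ∀ n (τ : ℝ) (u : D) x y, x ≤ y → y ≤ τ →
        IntervalIntegrable (fun r => Vn n (τ - r) (b u r)) volume x y := by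
      intro n τ u x y hxy hy
      refine ((hcc n τ u).continuousOn.congr fun r hr => ?_).intervalIntegrable
      rw [uIcc_of_le hxy] at hr
      rw [max_eq_left (by linarith [hr.2])]
    have key : ∀ u : D, Vn (m + 1) (t + s) (u : E) =
        ∑ p ∈ Finset.HasAntidiagonal.antidiagonal (m + 1), Vn p.1 t (Vn p.2 s (u : E)) := by
      intro u
      rw [Finset.Nat.sum_antidiagonal_succ', hrec m (t + s) (by linarith) u,
        ← intervalIntegral.integral_add_adjacent_intervals
          (hiii m (t + s) u 0 s hs (by linarith)) (hiii m (t + s) u s (t + s) (by linarith) le_rfl)]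
      rw [add_comm]
      congr 1
      · have := hrec m t ht ⟨Vn 0 s (u : E), hUD s hs u⟩
        simp only at this
        rw [this]
        have h2 := intervalIntegral.integral_comp_add_right (a := 0) (b := t)
          (fun r => Vn m (t + s - r) (b u r)) s
        rw [zero_add] at h2
        rw [← h2]
        refine intervalIntegral.integral_congr fun r hr => ?_
        rw [uIcc_of_le ht] at hr
        rw [hbU s hs u r hr.1]
        congr 2
        ring
      · have h3 : ∀ p ∈ Finset.HasAntidiagonal.antidiagonal m, Vn p.1 t (Vn (p.2 + 1) s (u : E)) =
            ∫ r in (0:ℝ)..s, Vn p.1 t (Vn p.2 (s - r) (b u r)) := by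
          intro p _
          rw [hrec p.2 s hs u, ContinuousLinearMap.intervalIntegral_comp_comm _
            (hiii p.2 s u 0 s hs le_rfl)]
        rw [Finset.sum_congr rfl h3, ← intervalIntegral.integral_finsetSum]
        · refine intervalIntegral.integral_congr fun r hr => ?_
          rw [uIcc_of_le hs] at hr
          rw [add_sub_assoc, ih t (s - r) ht (by linarith [hr.2])]
        · intro p _
          have := hiii p.2 s u 0 s hs le_rfl
          exact ⟨(Vn p.1 t).integrable_comp this.1, (Vn p.1 t).integrable_comp this.2⟩
    have hl : Continuous fun u : E => Vn (m + 1) (t + s) u := by fun_prop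
    have hr : Continuous fun u : E =>
        ∑ p ∈ Finset.HasAntidiagonal.antidiagonal (m + 1), Vn p.1 t (Vn p.2 s u) := by fun_prop
    exact congrFun (Continuous.ext_on hD hl hr fun x hx => key ⟨x, hx⟩) u

lemma avg_tendsto {f : ℝ → E} (hc : ContinuousOn f (Ici (0 : ℝ))) {h : ℝ} (hh : 0 ≤ h) :
    Tendsto (fun t : ℝ => t⁻¹ • ∫ s in h..(h + t), f s) (𝓝[>] 0) (𝓝 (f h)) := by
  have hc' : Continuous fun s => f (max s 0) :=
    hc.comp_continuous (by fun_prop) (fun t => mem_Ici.2 (le_max_right _ _))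
  have h1 := (intervalIntegral.integral_hasDerivAt_right (hc'.intervalIntegrable h h)
    (hc'.stronglyMeasurableAtFilter _ _) hc'.continuousAt).tendsto_slope_zero_right
  simp only [intervalIntegral.integral_same, sub_zero, max_eq_left hh] at h1
  refine h1.congr' ?_
  filter_upwards [self_mem_nhdsWithin] with t ht
  have ht : 0 < t := ht
  congr 1
  refine intervalIntegral.integral_congr fun s hs => ?_
  rw [uIcc_of_le (by linarith)] at hs
  rw [max_eq_left (hh.trans hs.1)]

lemma bs_bound {T : ℝ → E →L[ℝ] E} (h : ∀ u, ∃ C, ∀ t, 0 ≤ t → ‖T t u‖ ≤ C) :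
    ∃ M, 0 ≤ M ∧ ∀ t, 0 ≤ t → ∀ u, ‖T t u‖ ≤ M * ‖u‖ := by
  obtain ⟨C, hC⟩ := banach_steinhaus (g := fun t : Ici (0:ℝ) => T t)
    (fun u => by
      obtain ⟨C, hC⟩ := h u
      exact ⟨C, fun t => hC t t.2⟩)
  refine ⟨C, (norm_nonneg _).trans (hC ⟨0, mem_Ici.2 le_rfl⟩), fun t ht u => ?_⟩
  exact ((T t).le_opNorm u).trans (by gcongr; exact hC ⟨t, ht⟩)

end Semi

section Gen

variable {X : Type*} [NormedAddCommGroup X] [NormedSpace ℝ X] [CompleteSpace X] [PartialOrder X]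

lemma gen_comm {T : ℝ → X →L[ℝ] X} (hT : IsC0Semigroup T) {A : X →ₗ.[ℝ] X}
    (hA : IsGeneratorOf A T) {s : ℝ} (hs : 0 ≤ s) (u : A.domain) (hm : T s (u : X) ∈ A.domain) :
    A ⟨T s (u : X), hm⟩ = T s (A u) := by
  refine tendsto_nhds_unique (hA.2 ⟨T s (u : X), hm⟩) ?_
  have h1 := ((T s).continuous.tendsto _).comp (hA.2 u)
  refine h1.congr' ?_
  filter_upwards [self_mem_nhdsWithin] with t ht
  have ht : 0 < t := ht
  simp only [Function.comp, map_smul, map_sub]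
  congr 2
  have e1 := hT.map_add s t hs ht.le
  have e2 := hT.map_add t s ht.le hs
  rw [add_comm] at e2
  have := congrArg (fun L : X →L[ℝ] X => L (u : X)) (e1.symm.trans e2)
  simpa using this

lemma gen_deriv {T : ℝ → X →L[ℝ] X} (hT : IsC0Semigroup T) {A : X →ₗ.[ℝ] X}
    (hA : IsGeneratorOf A T) (u : A.domain) {x : ℝ} (hx : 0 ≤ x) :
    HasDerivWithinAt (fun t => T t (u : X)) (T x (A u)) (Ioi x) x := by
  rw [hasDerivWithinAt_iff_tendsto_slope' (by simp)]
  have h1 := ((T x).continuous.tendsto _).comp (hA.2 u)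
  have h2 : Tendsto (fun y : ℝ => y - x) (𝓝[>] x) (𝓝[>] 0) := by
    refine tendsto_nhdsWithin_iff.2 ⟨?_, ?_⟩
    · have : Continuous fun y : ℝ => y - x := by fun_prop
      simpa using (this.tendsto x).mono_left nhdsWithin_le_nhds
    · filter_upwards [self_mem_nhdsWithin] with y hy
      exact mem_Ioi.2 (sub_pos.2 hy)
  refine (h1.comp h2).congr' ?_
  filter_upwards [self_mem_nhdsWithin] with y hy
  have hy : x < y := hy
  simp only [Function.comp, map_smul, map_sub, slope_def_module]
  congr 2
  have e1 := hT.map_add x (y - x) hx (by linarith)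
  rw [add_sub_cancel] at e1
  rw [e1]
  rfl

lemma lap_gen {T : ℝ → X →L[ℝ] X} (hT : IsC0Semigroup T) {A : X →ₗ.[ℝ] X}
    (hA : IsGeneratorOf A T) {M : ℝ} (hM : ∀ t, 0 ≤ t → ∀ u, ‖T t u‖ ≤ M * ‖u‖) (u : A.domain) :
    (∫ t in Ioi (0:ℝ), Real.exp (-t) • T t ((u : X) - A u)) = u := by
  have hec : Continuous fun t : ℝ => Real.exp (-t) := by fun_prop
  have hi := lap_integrable (hT.strongCont ((u : X) - A u)) (fun t ht => hM t ht _)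
  have h1 := intervalIntegral_tendsto_integral_Ioi (0:ℝ) hi tendsto_id
  refine tendsto_nhds_unique h1 ?_
  have h2 : ∀ τ : ℝ, 0 ≤ τ → (u : X) - Real.exp (-τ) • T τ (u : X) =
      ∫ t in (0:ℝ)..τ, Real.exp (-t) • T t ((u : X) - A u) := by
    intro τ hτ
    have := intervalIntegral.integral_eq_sub_of_hasDeriv_right_of_le hτ
      (f := fun t => -(Real.exp (-t) • T t (u : X)))
      (f' := fun t => Real.exp (-t) • T t ((u : X) - A u)) ?_ ?_ ?_
    · rw [this]
      simp [hT.map_zero]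
      abel
    · exact (hec.continuousOn.smul ((hT.strongCont u).mono Icc_subset_Ici_self)).neg
    · intro x hx
      have d1 : HasDerivWithinAt (fun t : ℝ => Real.exp (-t)) (-Real.exp (-x)) (Ioi x) x := by
        have := ((hasDerivAt_id x).neg.exp).hasDerivWithinAt (s := Ioi x)
        simpa using this
      have := (d1.smul (gen_deriv hT hA u hx.1.le)).neg
      refine HasDerivWithinAt.congr_deriv this ?_
      rw [map_sub, smul_sub, neg_smul]
      abel
    · exact ii_of_cont (hec.continuousOn.smul (hT.strongCont _)) le_rfl hτ
  have h3 : Tendsto (fun τ : ℝ => (u : X) - Real.exp (-τ) • T τ (u : X)) atTop (𝓝 ((u : X) - 0)) := by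
    refine tendsto_const_nhds.sub ?_
    refine squeeze_zero_norm' (a := fun τ => Real.exp (-τ) * (M * ‖(u : X)‖)) ?_ ?_
    · filter_upwards [eventually_ge_atTop 0] with τ hτ
      rw [norm_smul, Real.norm_of_nonneg (Real.exp_pos _).le]
      exact mul_le_mul_of_nonneg_left (hM τ hτ _) (Real.exp_pos _).le
    · simpa using (Real.tendsto_exp_neg_atTop_nhds_zero).mul_const (M * ‖(u : X)‖)
  rw [sub_zero] at h3
  refine h3.congr' ?_
  filter_upwards [eventually_ge_atTop 0] with τ hτ
  exact h2 τ hτ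

lemma gen_int {T : ℝ → X →L[ℝ] X} (hT : IsC0Semigroup T) {A : X →ₗ.[ℝ] X}
    (hA : IsGeneratorOf A T) (u : X) {h : ℝ} (hh : 0 ≤ h)
    (hm : (∫ s in (0:ℝ)..h, T s u) ∈ A.domain) :
    A ⟨∫ s in (0:ℝ)..h, T s u, hm⟩ = T h u - u := by
  refine tendsto_nhds_unique (hA.2 ⟨_, hm⟩) ?_
  have hii : ∀ a b, 0 ≤ a → 0 ≤ b → IntervalIntegrable (fun s => T s u) volume a b :=
    fun a b ha hb => ii_of_cont (hT.strongCont u) ha hb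
  have h1 := (avg_tendsto (hT.strongCont u) hh).sub (avg_tendsto (hT.strongCont u) le_rfl)
  simp only [hT.map_zero, ContinuousLinearMap.id_apply, zero_add] at h1
  refine h1.congr' ?_
  filter_upwards [self_mem_nhdsWithin] with t ht
  have ht : 0 < t := ht
  rw [← smul_sub]
  congr 1
  rw [← ContinuousLinearMap.intervalIntegral_comp_comm _ (hii 0 h le_rfl hh)]
  have e1 : (∫ s in (0:ℝ)..h, T t (T s u)) = ∫ s in t..(h + t), T s u := by
    have h2 := intervalIntegral.integral_comp_add_right (a := 0) (b := h) (fun s => T s u) t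
    rw [zero_add] at h2
    rw [← h2]
    refine intervalIntegral.integral_congr fun s hs => ?_
    rw [uIcc_of_le hh] at hs
    rw [add_comm, hT.map_add t s ht.le hs.1]
    rfl
  rw [e1]
  have e2 := intervalIntegral.integral_add_adjacent_intervals (hii 0 t le_rfl ht.le)
    (hii t (h + t) ht.le (by linarith))
  have e3 := intervalIntegral.integral_add_adjacent_intervals (hii 0 h le_rfl hh)
    (hii h (h + t) hh (by linarith))
  rw [← e3] at e2
  rw [eq_sub_iff_add_eq, sub_add_eq_add_sub, sub_eq_iff_eq_add, add_comm, ← e2, add_comm]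

end Gen
section IntClm

variable {E : Type*} [NormedAddCommGroup E] [NormedSpace ℝ E] [CompleteSpace E]

lemma int_clm {T : ℝ → E →L[ℝ] E} (hc : ∀ u, ContinuousOn (fun t => T t u) (Ici (0 : ℝ)))
    {M : ℝ} (hM : ∀ t, 0 ≤ t → ∀ u, ‖T t u‖ ≤ M * ‖u‖) {h : ℝ} (hh : 0 ≤ h) :
    ∃ L : E →L[ℝ] E, ∀ u, L u = ∫ t in (0:ℝ)..h, T t u := by
  have hi : ∀ u, IntervalIntegrable (fun t => T t u) volume 0 h := fun u =>
    ii_of_cont (hc u) le_rfl hh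
  let L : E →ₗ[ℝ] E :=
    { toFun := fun u => ∫ t in (0:ℝ)..h, T t u
      map_add' := by
        intro u v
        rw [← intervalIntegral.integral_add (hi u) (hi v)]
        simp
      map_smul' := by
        intro c u
        rw [RingHom.id_apply, ← intervalIntegral.integral_smul]
        simp }
  refine ⟨L.mkContinuous (M * |h - 0|) ?_, fun u => rfl⟩
  intro u
  change ‖∫ t in (0:ℝ)..h, T t u‖ ≤ M * |h - 0| * ‖u‖
  have := intervalIntegral.norm_integral_le_of_norm_le_const (a := (0:ℝ)) (b := h)
    (f := fun t => T t u) (C := M * ‖u‖) ?_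
  · refine this.trans (le_of_eq (by ring))
  · intro t ht
    rw [uIoc_of_le hh] at ht
    exact hM t ht.1.le u

end IntClm

/-- The functionals `â` and `ā` coincide on `D(G)`; consequently, a trajectory `(V(t)u)`,
`u ∈ X₊`, is honest if and only if it is mild honest. -/
theorem ahat_eq_abar
    (hconeadd : ∀ u v : X, 0 ≤ u → 0 ≤ v → 0 ≤ u + v)
    (hconesmul : ∀ (c : ℝ) (u : X), 0 ≤ c → 0 ≤ u → 0 ≤ c • u)
    (hgen : ∀ u : X, ∃ v w : X, 0 ≤ v ∧ 0 ≤ w ∧ u = v - w)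
    (haddnorm : ∀ u v : X, 0 ≤ u → 0 ≤ v → ‖u + v‖ = ‖u‖ + ‖v‖)
    (Ψ : X →L[ℝ] ℝ) (hΨ : ∀ u : X, 0 ≤ u → Ψ u = ‖u‖)
    (U : ℝ → X →L[ℝ] X) (hU : IsSubstochastic U)
    (A : X →ₗ.[ℝ] X) (hA : IsGeneratorOf A U)
    (B : A.domain →ₗ[ℝ] X)
    (hBpos : ∀ u : A.domain, 0 ≤ (u : X) → 0 ≤ B u)
    (hdiss : ∀ u : A.domain, 0 ≤ (u : X) → Ψ (A u + B u) ≤ 0)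
    -- the resolvent of A for λ > 0
    (RA : ℝ → X →L[ℝ] X)
    (hRAdom : ∀ (l : ℝ) (u : X), RA l u ∈ A.domain)
    (hRAeq : ∀ (l : ℝ), 0 < l → ∀ u : X, l • RA l u - A ⟨RA l u, hRAdom l u⟩ = u)
    (hRAinv : ∀ (l : ℝ), 0 < l → ∀ v : A.domain, RA l (l • (v : X) - A v) = (v : X))
    -- the minimal substochastic semigroup V generated by an extension G of A + B
    (G : X →ₗ.[ℝ] X) (V : ℝ → X →L[ℝ] X)
    (hV : IsSubstochastic V) (hGV : IsGeneratorOf G V)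
    (hGext : ∀ u : A.domain, ∃ h : (u : X) ∈ G.domain, G ⟨(u : X), h⟩ = A u + B u)
    -- the resolvent of G for λ > 0 ...
    (RG : ℝ → X →L[ℝ] X)
    (hRGdom : ∀ (l : ℝ) (u : X), RG l u ∈ G.domain)
    (hRGeq : ∀ (l : ℝ), 0 < l → ∀ u : X, l • RG l u - G ⟨RG l u, hRGdom l u⟩ = u)
    (hRGinv : ∀ (l : ℝ), 0 < l → ∀ v : G.domain, RG l (l • (v : X) - G v) = (v : X))
    -- ... given by the strongly convergent series (λ-G)⁻¹u = Σₙ (λ-A)⁻¹[B(λ-A)⁻¹]ⁿu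
    (hseries : ∀ (l : ℝ), 0 < l → ∀ u : X,
      Tendsto (fun n : ℕ =>
          ∑ k ∈ Finset.range (n + 1), RA l ((Jfun A B (RA l) (hRAdom l))^[k] u))
        atTop (𝓝 (RG l u)))
    -- the series defining ā converges
    (hsum : ∀ (l : ℝ), 0 < l → ∀ u : X,
      Summable (fun n : ℕ =>
        aFun Ψ A B ⟨RA l ((Jfun A B (RA l) (hRAdom l))^[n] u), hRAdom l _⟩))
    -- U leaves D(A) invariant
    (hUdom : ∀ (s : ℝ), 0 ≤ s → ∀ u : A.domain, U s (u : X) ∈ A.domain)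
    -- the Dyson-Phillips iterates: V₀ = U, V_{n+1}(t)u = ∫₀ᵗ Vₙ(t-s) B U(s)u ds on D(A),
    -- each extended to a bounded positive operator on X
    (Vn : ℕ → ℝ → X →L[ℝ] X)
    (hVnpos : ∀ (n : ℕ) (t : ℝ), 0 ≤ t → ∀ u : X, 0 ≤ u → 0 ≤ Vn n t u)
    (hVncont : ∀ (n : ℕ) (u : X), ContinuousOn (fun t => Vn n t u) (Ici (0 : ℝ)))
    (hV0 : Vn 0 = U)
    (hVrec : ∀ (n : ℕ) (t : ℝ), 0 ≤ t → ∀ u : A.domain,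
      Vn (n + 1) t (u : X) =
        ∫ s in (0:ℝ)..t,
          Vn n (t - s) (B ⟨U (max s 0) (u : X), hUdom (max s 0) (le_max_right _ _) u⟩))
    -- V(t)u = Σₙ Vₙ(t)u
    (hVsum : ∀ (t : ℝ), 0 ≤ t → ∀ u : X,
      Tendsto (fun n : ℕ => ∑ k ∈ Finset.range (n + 1), Vn k t u) atTop (𝓝 (V t u)))
    -- ∫₀ᵗ Vₙ(s)u ds belongs to D(A), and ∫₀ᵗ V(s)u ds belongs to D(G)
    (memInt : ∀ (n : ℕ) (t : ℝ) (u : X), (∫ s in (0:ℝ)..t, Vn n s u) ∈ A.domain)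
    (hint : ∀ (u : X) (t : ℝ), (∫ s in (0:ℝ)..t, V s u) ∈ G.domain) :
    -- â = ā on D(G)
    (∀ v : G.domain,
      ahatFun Ψ A B Vn memInt (v : X) = abarOn Ψ A B G (RA 1) (hRAdom 1) 1 v) ∧
    -- honest ↔ mild honest
    (∀ u : X, 0 ≤ u →
      ((∀ t : ℝ, 0 ≤ t →
          ‖V t u‖ = ‖u‖ -
            abarOn Ψ A B G (RA 1) (hRAdom 1) 1 ⟨∫ s in (0:ℝ)..t, V s u, hint u t⟩) ↔
        (∀ t : ℝ, 0 ≤ t →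
          ‖V t u‖ = ‖u‖ - ahatFun Ψ A B Vn memInt (∫ s in (0:ℝ)..t, V s u)))) := by
  classical
  subst hV0
  obtain ⟨hUs, hUp⟩ := hU
  obtain ⟨hVs, hVp⟩ := hV
  -- the closed cone
  set K : Set X := closure {u : X | 0 ≤ u} with hK
  have hcl : IsClosed K := isClosed_closure
  have hsub : ∀ u : X, 0 ≤ u → u ∈ K := fun u hu => subset_closure hu
  have h0 : (0 : X) ∈ K := hsub 0 le_rfl
  have hadd : ∀ u ∈ K, ∀ v ∈ K, u + v ∈ K := fun u hu v hv =>
    map_mem_closure₂ continuous_add hu hv (fun a ha b hb => hconeadd a b ha hb)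
  have hsm : ∀ c : ℝ, 0 ≤ c → ∀ u ∈ K, c • u ∈ K := fun c hc u hu =>
    map_mem_closure (continuous_const_smul c) hu (fun a ha => hconesmul c a hc ha)
  have hΨK : ∀ u ∈ K, Ψ u = ‖u‖ := by
    have hc : IsClosed {u : X | Ψ u = ‖u‖} := isClosed_eq Ψ.continuous continuous_norm
    exact fun u hu => closure_minimal (fun u hu => hΨ u hu) hc hu
  have hVnK : ∀ n t, 0 ≤ t → ∀ u ∈ K, Vn n t u ∈ K := fun n t ht u hu =>
    map_mem_closure (Vn n t).continuous hu (fun a ha => hVnpos n t ht a ha)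
  have hVK : ∀ t, 0 ≤ t → ∀ u ∈ K, V t u ∈ K := fun t ht u hu =>
    map_mem_closure (V t).continuous hu (fun a ha => (hVp t ht a ha).1)
  have hVle : ∀ t, 0 ≤ t → ∀ u ∈ K, ‖V t u‖ ≤ ‖u‖ := by
    intro t ht
    have hc : IsClosed {u : X | ‖V t u‖ ≤ ‖u‖} :=
      isClosed_le (V t).continuous.norm continuous_norm
    exact fun u hu => closure_minimal (fun u hu => (hVp t ht u hu).2) hc hu
  -- bounds
  have hVnle : ∀ n t, 0 ≤ t → ∀ u ∈ K, ‖Vn n t u‖ ≤ ‖u‖ := by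
    intro n t ht u hu
    refine le_trans ?_ (hVle t ht u hu)
    rw [← hΨK _ (hVnK n t ht u hu), ← hΨK _ (hVK t ht u hu)]
    refine ge_of_tendsto ((Ψ.continuous.tendsto _).comp (hVsum t ht u)) ?_
    filter_upwards [eventually_ge_atTop n] with N hN
    simp only [Function.comp, map_sum]
    refine Finset.single_le_sum (f := fun k => Ψ (Vn k t u)) (fun k _ => ?_)
      (Finset.mem_range.2 (by omega))
    rw [hΨK _ (hVnK k t ht u hu)]
    exact norm_nonneg _
  have hMex : ∀ n, ∃ M, 0 ≤ M ∧ ∀ t, 0 ≤ t → ∀ u, ‖Vn n t u‖ ≤ M * ‖u‖ := by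
    intro n
    refine bs_bound fun u => ?_
    obtain ⟨v, w, hv, hw, rfl⟩ := hgen u
    refine ⟨‖v‖ + ‖w‖, fun t ht => ?_⟩
    rw [map_sub]
    exact (norm_sub_le _ _).trans
      (add_le_add (hVnle n t ht v (hsub v hv)) (hVnle n t ht w (hsub w hw)))
  choose M hM0 hM using hMex
  -- injectivity of the resolvent of G
  have hRGinj : ∀ x y, RG 1 x = RG 1 y → x = y := by
    intro x y hxy
    have e1 := hRGeq 1 one_pos x
    have e2 := hRGeq 1 one_pos y
    have : (⟨RG 1 x, hRGdom 1 x⟩ : G.domain) = ⟨RG 1 y, hRGdom 1 y⟩ := Subtype.ext hxy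
    rw [← e1, ← e2, this, hxy]
  -- boundedness of J
  have hBcongr : ∀ (x y : X) (hx : x ∈ A.domain) (hy : y ∈ A.domain), x = y →
      B ⟨x, hx⟩ = B ⟨y, hy⟩ := by
    intro x y hx hy hxy
    subst hxy
    rfl
  let J : X →ₗ[ℝ] X := B ∘ₗ ((RA 1 : X →ₗ[ℝ] X).codRestrict A.domain (hRAdom 1))
  have hJ : ∀ u, J u = B ⟨RA 1 u, hRAdom 1 u⟩ := fun u => rfl
  have hRAG : ∀ z, RA 1 z = RG 1 (z - J z) := by
    intro z
    obtain ⟨hm, hGe⟩ := hGext ⟨RA 1 z, hRAdom 1 z⟩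
    have e1 := hRGinv 1 one_pos ⟨RA 1 z, hm⟩
    have e2 := hRAeq 1 one_pos z
    rw [one_smul] at e1 e2
    simp only at e1 hGe
    rw [← e1, hGe, hJ]
    congr 1
    rw [← sub_sub, e2]
  have hJc : Continuous J := by
    refine LinearMap.continuous_of_seq_closed_graph J fun x z y hx hy => ?_
    have h1 : Tendsto (fun n => RA 1 (x n)) atTop (𝓝 (RG 1 (z - y))) := by
      have := ((RG 1).continuous.tendsto (z - y)).comp (hx.sub hy)
      exact this.congr fun n => (hRAG _).symm
    have h2 := tendsto_nhds_unique h1 (((RA 1).continuous.tendsto z).comp hx)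
    rw [hRAG z] at h2
    have := hRGinj _ _ h2
    exact sub_right_injective this
  let Jc : X →L[ℝ] X := ⟨J, hJc⟩
  have hJcJ : ∀ u, Jc u = J u := fun u => rfl
  -- B U(s) u
  have hBU : ∀ s (hs : 0 ≤ s) (u : A.domain) (hm : Vn 0 s (u : X) ∈ A.domain),
      B ⟨Vn 0 s (u : X), hm⟩ = Jc (Vn 0 s ((u : X) - A u)) := by
    intro s hs u hm
    rw [hJcJ, hJ]
    refine hBcongr _ _ _ _ ?_
    have e1 := hRAinv 1 one_pos ⟨Vn 0 s (u : X), hm⟩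
    rw [one_smul, gen_comm hUs hA hs u hm] at e1
    rw [map_sub]
    exact e1.symm
  have hdense : Dense (A.domain : Set X) := by
    intro x
    have h1 := avg_tendsto (hVncont 0 x) le_rfl
    rw [hUs.map_zero, ContinuousLinearMap.id_apply] at h1
    refine mem_closure_of_tendsto h1 (Eventually.of_forall fun t => ?_)
    rw [zero_add]
    exact A.domain.smul_mem _ (memInt 0 t x)
  let b : A.domain → ℝ → X := fun u s => Jc (Vn 0 (max s 0) ((u : X) - A u))
  have hbdef : ∀ u s, b u s = Jc (Vn 0 (max s 0) ((u : X) - A u)) := fun u s => rfl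
  have hbc : ∀ u, Continuous (b u) := fun u =>
    Jc.continuous.comp ((hVncont 0 _).comp_continuous (by fun_prop)
      (fun t => mem_Ici.2 (le_max_right _ _)))
  have hrec : ∀ n t, 0 ≤ t → ∀ u : A.domain,
      Vn (n + 1) t (u : X) = ∫ s in (0:ℝ)..t, Vn n (t - s) (b u s) := by
    intro n t ht u
    rw [hVrec n t ht u]
    refine intervalIntegral.integral_congr fun s _ => ?_
    simp only [hBU (max s 0) (le_max_right _ _) u, hbdef]
  have hUadd : ∀ t s, 0 ≤ t → 0 ≤ s → ∀ u, Vn 0 (t + s) u = Vn 0 t (Vn 0 s u) := by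
    intro t s ht hs u
    rw [hUs.map_add t s ht hs]
    rfl
  have SL := dyson_SL hVncont hM A.domain hdense b hbc hrec hUdom (by
    intro s hs u r hr
    rw [hbdef, hbdef, gen_comm hUs hA hs u, max_eq_left hr, max_eq_left (add_nonneg hr hs),
      hUadd r s hr hs]
    simp only [map_sub]) hUadd
  -- Laplace transforms
  have hLex : ∀ n, ∃ L : X →L[ℝ] X, ∀ u, L u = ∫ t in Ioi (0 : ℝ), Real.exp (-t) • Vn n t u :=
    fun n => lap_clm (hVncont n) (hM n)
  choose L hL using hLex
  have hL0 : ∀ u, L 0 u = RA 1 u := by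
    intro u
    rw [hL]
    have e1 := hRAeq 1 one_pos u
    rw [one_smul] at e1
    have e2 := lap_gen hUs hA (hM 0) ⟨RA 1 u, hRAdom 1 u⟩
    simp only [e1] at e2
    exact e2
  have hLs : ∀ n u, L (n + 1) u = L n (J u) := by
    intro n u
    have hkey : ∀ u : A.domain, L (n + 1) (u : X) = L n (Jc (u : X)) := by
      intro u
      have hbb : ∀ t, ‖b u t‖ ≤ ‖Jc‖ * (M 0 * ‖(u : X) - A u‖) := by
        intro t
        rw [hbdef]
        exact (Jc.le_opNorm _).trans (by gcongr; exact hM 0 _ (le_max_right _ _) _)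
      have h1 := lap_conv (hVncont n) (hM n) (hbc u) hbb (hM0 n) (L n) (hL n)
      have h2 : (∫ s in Ioi (0:ℝ), Real.exp (-s) • b u s) = Jc (u : X) := by
        have e1 := lap_gen hUs hA (hM 0) u
        rw [← e1, ← Jc.integral_comp_comm
          (lap_integrable (hVncont 0 _) (fun t ht => hM 0 t ht _))]
        refine setIntegral_congr_fun measurableSet_Ioi fun s hs => ?_
        have hs : 0 < s := hs
        simp only [hbdef, map_smul, max_eq_left hs.le]
      rw [← h2, ← h1, hL]
      refine setIntegral_congr_fun measurableSet_Ioi fun t ht => ?_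
      have ht : 0 < t := ht
      rw [hrec n t ht.le u]
    have hl : Continuous fun u : X => L (n + 1) u := by fun_prop
    have hr : Continuous fun u : X => L n (Jc u) := by fun_prop
    exact congrFun (Continuous.ext_on hdense hl hr fun x hx => hkey ⟨x, hx⟩) u
  have hJfun : Jfun A B (RA 1) (hRAdom 1) = J := rfl
  have hLn : ∀ n u, L n u = RA 1 ((Jfun A B (RA 1) (hRAdom 1))^[n] u) := by
    intro n
    induction n with
    | zero => exact fun u => hL0 u
    | succ n ih =>
      intro u
      rw [hLs, ih, Function.iterate_succ_apply, hJfun]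
  -- the functional
  obtain ⟨α, hαe⟩ := LinearMap.exists_extend (-((Ψ : X →ₗ[ℝ] ℝ) ∘ₗ G.toFun))
  have hαG : ∀ w : G.domain, α (w : X) = -Ψ (G w) := by
    intro w
    have := congrArg (fun f => f w) hαe
    exact this
  have hAG : ∀ w ∈ A.domain, w ∈ G.domain := fun w hw => (hGext ⟨w, hw⟩).1
  have hαA : ∀ w : A.domain, aFun Ψ A B w = α (w : X) := by
    intro w
    obtain ⟨hm, hGe⟩ := hGext w
    have := hαG ⟨w, hm⟩
    rw [hGe] at this
    exact this.symm
  have hα : ∀ w ∈ G.domain, w ∈ K → 0 ≤ α w := by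
    intro w hw hwK
    have h1 := (Ψ.continuous.tendsto _).comp (hGV.2 ⟨w, hw⟩)
    have h2 : Ψ (G ⟨w, hw⟩) ≤ 0 := by
      refine le_of_tendsto h1 ?_
      filter_upwards [self_mem_nhdsWithin] with t ht
      have ht : 0 < t := ht
      simp only [Function.comp, map_smul, map_sub, smul_eq_mul]
      rw [hΨK _ (hVK t ht.le w hwK), hΨK _ hwK]
      exact mul_nonpos_of_nonneg_of_nonpos (inv_nonneg.2 ht.le)
        (sub_nonpos.2 (hVle t ht.le w hwK))
    have := hαG ⟨w, hw⟩
    simp only at this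
    linarith
  have memD : ∀ (n : ℕ) (t : ℝ) (u : X), (∫ s in (0:ℝ)..t, Vn n s u) ∈ G.domain :=
    fun n t u => hAG _ (memInt n t u)
  have hαc : ∀ (n : ℕ) (t : ℝ), 0 ≤ t → Continuous fun u => α (∫ s in (0:ℝ)..t, Vn n s u) := by
    intro n t ht
    obtain ⟨P, hP⟩ := int_clm (hVncont n) (hM n) ht
    have hPD : ∀ u, P u ∈ G.domain := fun u => by rw [hP]; exact memD n t u
    let Q : X →ₗ[ℝ] X := G.toFun ∘ₗ ((P : X →ₗ[ℝ] X).codRestrict G.domain hPD)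
    have hQ : ∀ u, Q u = G ⟨P u, hPD u⟩ := fun u => rfl
    have hPQ : ∀ u, RG 1 (P u - Q u) = P u := by
      intro u
      have := hRGinv 1 one_pos ⟨P u, hPD u⟩
      rw [one_smul] at this
      exact this
    have hQc : Continuous Q := by
      refine LinearMap.continuous_of_seq_closed_graph Q fun x z y hx hy => ?_
      have hPx := (P.continuous.tendsto z).comp hx
      have h1 : Tendsto (fun n => P (x n)) atTop (𝓝 (RG 1 (P z - y))) := by
        have := ((RG 1).continuous.tendsto (P z - y)).comp (hPx.sub hy)
        exact this.congr fun n => hPQ _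
      have h2 := tendsto_nhds_unique h1 hPx
      rw [← hPQ z] at h2
      have h3 := hRGinj _ _ h2
      rw [hPQ z] at h3
      exact sub_right_injective h3
    have : (fun u => α (∫ s in (0:ℝ)..t, Vn n s u)) = fun u => -Ψ (Q u) := by
      ext u
      rw [← hP, hQ]
      exact hαG ⟨P u, hPD u⟩
    rw [this]
    exact (Ψ.continuous.comp hQc).neg
  have hLD : ∀ m u, L m u ∈ G.domain := by
    intro m u
    rw [hLn]
    exact hAG _ (hRAdom _ _)
  have hsumL : ∀ u, Summable fun m => α (L m u) := by
    intro u
    refine (hsum 1 one_pos u).congr fun m => ?_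
    rw [hαA, hLn]
  have hcore : ∀ u, 0 ≤ u →
      (∀ h, 0 ≤ h → Summable fun n => α (∫ s in (0:ℝ)..h, Vn n s (RG 1 u))) ∧
      Tendsto (fun h : ℝ => h⁻¹ * ∑' n, α (∫ s in (0:ℝ)..h, Vn n s (RG 1 u))) (𝓝[>] 0)
        (𝓝 (∑' m, α (L m u))) := by
    intro u hu0
    have hu := hsub u hu0
    refine core hcl hadd hsm h0 G.domain α hα hVncont hM hVnK SL memD hαc
      (I := fun m u => L m u) hL hLD hu (hsumL u) ?_ (σ := fun h => Ψ u - Ψ (V h u)) ?_ ?_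
    · refine (hseries 1 one_pos u).congr fun n => ?_
      refine Finset.sum_congr rfl fun k _ => ?_
      rw [hLn]
    · intro h hh N
      have hiiV : IntervalIntegrable (fun s => V s u) volume 0 h :=
        ii_of_cont (hVs.strongCont u) le_rfl hh
      have hiin : ∀ n ∈ Finset.range N, IntervalIntegrable (fun s => Vn n s u) volume 0 h :=
        fun n _ => ii_of_cont (hVncont n u) le_rfl hh
      have hcs : ContinuousOn (fun s => ∑ n ∈ Finset.range N, Vn n s u) (Ici (0:ℝ)) :=
        continuousOn_finsetSum _ fun n _ => hVncont n u
      have hiis : IntervalIntegrable (fun s => ∑ n ∈ Finset.range N, Vn n s u) volume 0 h :=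
        ii_of_cont hcs le_rfl hh
      have hmem : (∫ s in (0:ℝ)..h, V s u) - ∑ n ∈ Finset.range N, (∫ s in (0:ℝ)..h, Vn n s u)
          ∈ K := by
        rw [← intervalIntegral.integral_finsetSum hiin, ← intervalIntegral.integral_sub hiiV hiis]
        refine cone_int hcl hadd hsm h0 hh (hiiV.sub hiis) fun s hs _ => ?_
        refine hcl.mem_of_tendsto ((hVsum s hs.le u).sub_const _) ?_
        filter_upwards [eventually_ge_atTop N] with n hn
        rw [← Finset.sum_Ico_eq_sub _ (by omega : N ≤ n + 1)]
        refine Finset.sum_induction _ (· ∈ K) (fun a b ha hb => hadd a ha b hb) h0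
          fun k _ => hVnK k s hs.le u hu
      have hp := hα _ (G.domain.sub_mem (hint u h) (G.domain.sum_mem fun n _ => memD n h u)) hmem
      rw [map_sub, map_sum] at hp
      have e1 := hαG ⟨_, hint u h⟩
      rw [gen_int hVs hGV u hh (hint u h)] at e1
      simp only [map_sub] at e1
      linarith
    · have h1 := hVs.strongCont u 0 (mem_Ici.2 le_rfl)
      have h2 : Tendsto (fun t => V t u) (𝓝[>] 0) (𝓝 (V 0 u)) :=
        h1.tendsto.mono_left (nhdsWithin_mono _ Ioi_subset_Ici_self)
      rw [hVs.map_zero, ContinuousLinearMap.id_apply] at h2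
      have h3 := ((Ψ.continuous.tendsto u).comp h2).const_sub (Ψ u)
      simpa using h3
  have claim1 : ∀ v : G.domain,
      ahatFun Ψ A B Vn memInt (v : X) = abarOn Ψ A B G (RA 1) (hRAdom 1) 1 v := by
    intro v
    obtain ⟨u1, u2, hu1, hu2, hu⟩ := hgen ((1:ℝ) • (v : X) - G v)
    have hv : (v : X) = RG 1 u1 - RG 1 u2 := by
      rw [← map_sub, ← hu, hRGinv 1 one_pos v]
    obtain ⟨s1, t1⟩ := hcore u1 hu1
    obtain ⟨s2, t2⟩ := hcore u2 hu2
    have hR : abarOn Ψ A B G (RA 1) (hRAdom 1) 1 v =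
        (∑' m, α (L m u1)) - ∑' m, α (L m u2) := by
      rw [← (hsumL u1).tsum_sub (hsumL u2)]
      unfold abarOn abarRes
      refine tsum_congr fun m => ?_
      rw [hαA, hu, ← map_sub, ← map_sub, hLn]
    rw [hR]
    unfold ahatFun
    refine Tendsto.limUnder_eq ?_
    refine (t1.sub t2).congr' ?_
    filter_upwards [self_mem_nhdsWithin] with h hh
    have hh : 0 < h := hh
    rw [← mul_sub, ← (s1 h hh.le).tsum_sub (s2 h hh.le)]
    congr 1
    refine tsum_congr fun n => ?_
    rw [hαA, ← map_sub, ← intervalIntegral.integral_sub (ii_of_cont (hVncont n _) le_rfl hh.le)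
      (ii_of_cont (hVncont n _) le_rfl hh.le), hv]
    simp only [map_sub]
  refine ⟨claim1, fun u _ => ?_⟩
  refine forall_congr' fun t => forall_congr' fun _ => ?_
  rw [claim1 ⟨_, hint u t⟩]
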